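/- arXiv:2303.08277 — 3 statements merged into one kernel-verified Lean document; each statement's English description precedes it below -/
import Mathlib

section
/- For every integer k ≥ 1, the sum over m ≥ 1 of a_{m,k}/m equals ζ(k+1), where a_{m,k} is the probability that a uniformly random permutation of S_m has exactly k disjoint cycles. -/
open scoped BigOperators

/-- Number of disjoint cycles of a permutation of `Fin m`, counting fixed points
as 1-cycles. -/
noncomputable def cycleCount {m : ℕ} (σ : Equiv.Perm (Fin m)) : ℕ :=
  σ.cycleType.card + (m - σ.support.card)

/-- `aPerm m k` is the probability that a uniformly random permutation of `S_m`
has exactly `k` disjoint cycles. -/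
noncomputable def aPerm (m k : ℕ) : ℝ :=
  ((Finset.univ.filter fun σ : Equiv.Perm (Fin m) => cycleCount σ = k).card : ℝ) /
    (Nat.factorial m)

open Equiv Equiv.Perm Filter Topology

section CycleCount

variable {α : Type*} [Fintype α] [DecidableEq α]

lemma card_cycleType_swap_mul (τ : Perm α) {a b : α} (ha : τ a = a) (hab : a ≠ b) :
    (swap a b * τ).cycleType.card + τ.support.card + 1 =
      τ.cycleType.card + (swap a b * τ).support.card := by
  by_cases hb : τ b = b
  · have hd : Disjoint (swap a b) τ := by
      intro x
      by_cases h1 : x = a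
      · right; rw [h1, ha]
      by_cases h2 : x = b
      · right; rw [h2, hb]
      · left; exact swap_apply_of_ne_of_ne h1 h2
    rw [hd.cycleType_mul, hd.card_support_mul, (isCycle_swap hab).cycleType, card_support_swap hab]
    simp
    ring
  · set c := τ.cycleOf b with hc
    set r := τ * c⁻¹ with hr
    have hcm : c ∈ τ.cycleFactorsFinset :=
      cycleOf_mem_cycleFactorsFinset_iff.2 (mem_support.2 hb)
    have hcyc : c.IsCycle := isCycle_cycleOf τ hb
    have hdrc : Disjoint r c := disjoint_mul_inv_of_mem_cycleFactorsFinset hcm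
    have hτ : τ = c * r := by rw [← hdrc.commute.eq, hr]; simp
    have hca : c a = a := by
      by_contra h
      have h' := mem_support_cycleOf_iff.1 (mem_support.2 h)
      exact (mem_support.1 (h'.1.mem_support_iff.1 h'.2)) ha
    have hra : r a = a := by
      rw [hr, Perm.mul_apply, inv_eq_iff_eq.2 hca.symm, ha]
    obtain ⟨l, hl⟩ : ∃ l, toList τ b = b :: l := by
      cases h : toList τ b with
      | nil => exact absurd (mem_support.2 hb) (toList_eq_nil_iff.1 h)
      | cons x l =>
        refine ⟨l, ?_⟩
        have := toList_getElem_zero τ b (mem_support.2 hb)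
        simp [h] at this
        rw [this]
    have hfc : List.formPerm (b :: l) = c := by rw [← hl, formPerm_toList]
    have hlen : (b :: l).length = c.support.card := by rw [← hl, length_toList]
    have hmem : ∀ x ∈ b :: l, c x ≠ x := by
      intro x hx
      rw [← hl, mem_toList_iff] at hx
      exact mem_support.1 (mem_support_cycleOf_iff.2 hx)
    have hnd : (a :: b :: l).Nodup :=
      List.nodup_cons.2 ⟨fun h => hmem a h hca, hl ▸ nodup_toList τ b⟩
    set g := List.formPerm (a :: b :: l) with hg
    have hgs : swap a b * τ = g * r := by
      rw [hg, List.formPerm_cons_cons, hfc, mul_assoc, ← hτ]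
    have hgc : g.IsCycle := List.isCycle_formPerm hnd (by simp)
    have hgsupp : g.support.card = c.support.card + 1 := by
      rw [hg, List.support_formPerm_of_nodup _ hnd (by simp), List.toFinset_card_of_nodup hnd,
        ← hlen, List.length_cons]
    have hdgr : Disjoint g r := by
      intro x
      by_cases hx : g x = x
      · exact Or.inl hx
      · right
        rcases List.mem_cons.1 (List.mem_of_formPerm_apply_ne hx) with rfl | h
        · exact hra
        · exact (hdrc x).resolve_right (hmem x h)
    rw [hgs, hdgr.cycleType_mul, hdgr.card_support_mul, hgc.cycleType, hgsupp]
    have h1 : τ.cycleType = c.cycleType + r.cycleType := by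
      conv_lhs => rw [hτ, hdrc.symm.cycleType_mul]
    have h2 : τ.support.card = c.support.card + r.support.card := by
      conv_lhs => rw [hτ, hdrc.symm.card_support_mul]
    rw [h1, h2, hcyc.cycleType]
    simp
    ring

end CycleCount

lemma decomposeFin_symm_eq_swap_mul {n : ℕ} (p : Fin (n + 1)) (e : Perm (Fin n)) :
    decomposeFin.symm (p, e) = swap 0 p * decomposeFin.symm (0, e) := by
  ext x
  refine Fin.cases ?_ (fun i => ?_) x <;> simp

lemma decomposeFin_symm_zero_eq_extendDomain {n : ℕ} (e : Perm (Fin n)) :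
    decomposeFin.symm (0, e) = e.extendDomain (finSuccAboveEquiv (0 : Fin (n + 1))) := by
  ext x
  refine Fin.cases ?_ (fun i => ?_) x
  · rw [extendDomain_apply_not_subtype _ _ (by simp)]; simp
  · have h : i.succ = (finSuccAboveEquiv (0 : Fin (n + 1)) i : Fin (n + 1)) := by
      simp [finSuccAboveEquiv_apply]
    rw [decomposeFin_symm_apply_succ, h, extendDomain_apply_image]
    simp [finSuccAboveEquiv_apply]

lemma cycleCount_decomposeFin_symm_zero {n : ℕ} (e : Perm (Fin n)) :
    cycleCount (decomposeFin.symm (0, e)) = cycleCount e + 1 := by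
  rw [decomposeFin_symm_zero_eq_extendDomain, cycleCount, cycleCount, cycleType_extendDomain,
    card_support_extend_domain]
  have := e.support.card_le_univ
  simp at this
  omega

lemma cycleCount_decomposeFin_symm_succ {n : ℕ} (p : Fin n) (e : Perm (Fin n)) :
    cycleCount (decomposeFin.symm (p.succ, e)) = cycleCount e := by
  have h0 := cycleCount_decomposeFin_symm_zero e
  have h := card_cycleType_swap_mul (decomposeFin.symm (0, e)) (a := 0) (b := p.succ) (by simp)
    (Fin.succ_ne_zero p).symm
  rw [← decomposeFin_symm_eq_swap_mul] at h
  have h1 := (decomposeFin.symm (p.succ, e)).support.card_le_univ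
  have h2 := (decomposeFin.symm (0, e)).support.card_le_univ
  rw [Fintype.card_fin] at h1 h2
  unfold cycleCount at *
  omega

/-- The number of permutations of `Fin m` with `k` cycles is a Stirling number of the
first kind. -/
lemma card_filter_cycleCount_eq_stirlingFirst (m k : ℕ) :
    (Finset.univ.filter fun σ : Perm (Fin m) => cycleCount σ = k).card = Nat.stirlingFirst m k := by
  induction m generalizing k with
  | zero =>
    have h : ∀ σ : Perm (Fin 0), cycleCount σ = 0 := fun σ => by
      simp [cycleCount, Subsingleton.elim σ 1]
    cases k with
    | zero => simp [h]
    | succ k => simp [h]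
  | succ m ih =>
    simp only [← Fintype.card_subtype] at ih ⊢
    have hsum : ∀ k, Fintype.card {σ : Perm (Fin (m + 1)) // cycleCount σ = k} =
        Fintype.card {e : Perm (Fin m) // cycleCount e + 1 = k} +
          m * Fintype.card {e : Perm (Fin m) // cycleCount e = k} := by
      intro k
      simp only [Fintype.card_subtype, Finset.card_filter]
      rw [← decomposeFin.symm.sum_comp, Fintype.sum_prod_type, Fin.sum_univ_succ]
      simp [cycleCount_decomposeFin_symm_zero, cycleCount_decomposeFin_symm_succ]
    rw [hsum, ih]
    cases k with
    | zero =>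
      cases m <;> simp
    | succ k =>
      simp only [Nat.add_right_cancel_iff]
      rw [ih, Nat.stirlingFirst_succ_succ, add_comm]

lemma aPerm_eq_stirlingFirst_div (m k : ℕ) : aPerm m k = Nat.stirlingFirst m k / m.factorial := by
  rw [aPerm, card_filter_cycleCount_eq_stirlingFirst]

lemma aPerm_nonneg (m k : ℕ) : 0 ≤ aPerm m k := by
  unfold aPerm; positivity

lemma aPerm_succ_succ (m k : ℕ) :
    (m + 1 : ℝ) * aPerm (m + 1) (k + 1) = m * aPerm m (k + 1) + aPerm m k := by
  simp only [aPerm_eq_stirlingFirst_div, Nat.stirlingFirst_succ_succ, Nat.factorial_succ]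
  have : (m.factorial : ℝ) ≠ 0 := by positivity
  push_cast
  field_simp

lemma aPerm_zero_zero : aPerm 0 0 = 1 := by simp [aPerm_eq_stirlingFirst_div]

lemma aPerm_zero_succ (k : ℕ) : aPerm 0 (k + 1) = 0 := by simp [aPerm_eq_stirlingFirst_div]

lemma aPerm_succ_zero (m : ℕ) : aPerm (m + 1) 0 = 0 := by simp [aPerm_eq_stirlingFirst_div]

lemma mul_aPerm_succ_eq_sum (m k : ℕ) :
    (m : ℝ) * aPerm m (k + 1) = ∑ i ∈ Finset.range m, aPerm i k := by
  induction m with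
  | zero => simp
  | succ m ih =>
    rw [Finset.sum_range_succ, ← ih]
    exact_mod_cast aPerm_succ_succ m k

lemma tendsto_aPerm_atTop (k : ℕ) : Tendsto (fun m => aPerm m k) atTop (𝓝 0) := by
  induction k with
  | zero =>
    refine tendsto_const_nhds.congr' ?_
    filter_upwards [eventually_ge_atTop 1] with m hm
    obtain ⟨n, rfl⟩ := Nat.exists_eq_add_of_le' hm
    exact (aPerm_succ_zero n).symm
  | succ k ih =>
    refine ih.cesaro.congr' ?_
    filter_upwards [eventually_ge_atTop 1] with m hm
    have : (m : ℝ) ≠ 0 := by positivity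
    rw [← mul_aPerm_succ_eq_sum, inv_mul_cancel_left₀ this]

/-- The value `m! n! / (m + n + 1)!` of the Beta function at `(m + 1, n + 1)`. -/
noncomputable def natBeta (n m : ℕ) : ℝ := m.factorial * n.factorial / (m + n + 1).factorial

lemma natBeta_nonneg (n m : ℕ) : 0 ≤ natBeta n m := by
  unfold natBeta; positivity

lemma natBeta_succ_right (n m : ℕ) :
    (m + n + 2 : ℝ) * natBeta n (m + 1) = (m + 1) * natBeta n m := by
  unfold natBeta
  rw [show m + 1 + n + 1 = (m + n + 1) + 1 by ring, Nat.factorial_succ m,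
    Nat.factorial_succ (m + n + 1)]
  push_cast
  field_simp
  ring

lemma natBeta_succ_left (n m : ℕ) :
    (m + n + 2 : ℝ) * natBeta (n + 1) m = (n + 1) * natBeta n m := by
  unfold natBeta
  rw [show m + (n + 1) + 1 = (m + n + 1) + 1 by ring, Nat.factorial_succ n,
    Nat.factorial_succ (m + n + 1)]
  push_cast
  field_simp
  ring

lemma natBeta_zero_right (n : ℕ) : natBeta n 0 = 1 / (n + 1) := by
  unfold natBeta
  rw [zero_add, Nat.factorial_succ]
  push_cast
  field_simp
  simp

lemma natBeta_zero_left (m : ℕ) : natBeta 0 m = 1 / (m + 1) := by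
  unfold natBeta
  rw [add_zero, Nat.factorial_succ]
  push_cast
  field_simp
  simp

lemma mul_natBeta_le_one (n m : ℕ) : (m + n + 1 : ℝ) * natBeta n m ≤ 1 := by
  unfold natBeta
  rw [Nat.factorial_succ, ← mul_div_assoc, div_le_one (by positivity)]
  have : ((m.factorial * n.factorial : ℕ) : ℝ) ≤ ((m + n).factorial : ℕ) := by
    exact_mod_cast Nat.le_of_dvd (Nat.factorial_pos _)
      (Nat.factorial_mul_factorial_dvd_factorial_add m n)
  push_cast at this ⊢
  gcongr

lemma sum_range_aPerm_mul_natBeta (n k M : ℕ) :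
    ∑ m ∈ Finset.range M, aPerm m k * natBeta n m =
      (n + 1) * ∑ m ∈ Finset.range M, aPerm m (k + 1) * natBeta n m +
        (M + n + 1) * natBeta n M * aPerm M (k + 1) := by
  induction M with
  | zero => simp [aPerm_zero_succ]
  | succ M ih =>
    rw [Finset.sum_range_succ, Finset.sum_range_succ, ih]
    have h1 := aPerm_succ_succ M k
    have h2 := natBeta_succ_right n M
    push_cast
    linear_combination (-natBeta n M) * h1 - aPerm (M + 1) (k + 1) * h2

lemma hasSum_aPerm_mul_natBeta (n k : ℕ) :
    HasSum (fun m => aPerm m k * natBeta n m) (1 / (n + 1 : ℝ) ^ (k + 1)) := by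
  induction k with
  | zero =>
    convert hasSum_single (f := fun m => aPerm m 0 * natBeta n m) 0 ?_ using 1
    · simp [aPerm_zero_zero, natBeta_zero_right]
    · intro m hm
      obtain ⟨l, rfl⟩ := Nat.exists_eq_succ_of_ne_zero hm
      simp [aPerm_succ_zero]
  | succ k ih =>
    have hn : (n + 1 : ℝ) ≠ 0 := by positivity
    rw [hasSum_iff_tendsto_nat_of_nonneg fun m => mul_nonneg (aPerm_nonneg _ _) (natBeta_nonneg _ _)]
    have hb : Tendsto (fun M : ℕ => (M + n + 1) * natBeta n M * aPerm M (k + 1)) atTop (𝓝 0) := by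
      refine squeeze_zero (fun M => ?_) (fun M => ?_) (tendsto_aPerm_atTop (k + 1))
      · have := aPerm_nonneg M (k + 1)
        have := natBeta_nonneg n M
        positivity
      · exact mul_le_of_le_one_left (aPerm_nonneg _ _) (mul_natBeta_le_one n M)
    have h := (ih.tendsto_sum_nat.sub hb).div_const (n + 1 : ℝ)
    rw [show (1 / (n + 1 : ℝ) ^ (k + 1) - 0) / (n + 1) = 1 / (n + 1 : ℝ) ^ (k + 1 + 1) by
      rw [pow_succ _ (k + 1)]; field_simp; simp] at h
    refine h.congr fun M => ?_
    rw [sum_range_aPerm_mul_natBeta, add_sub_cancel_right, mul_div_cancel_left₀ _ hn]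

lemma hasSum_natBeta_succ (m : ℕ) :
    HasSum (fun n => natBeta n (m + 1)) (1 / (m + 1 : ℝ)) := by
  rw [hasSum_iff_tendsto_nat_of_nonneg fun n => natBeta_nonneg n (m + 1)]
  have hm : (m + 1 : ℝ) ≠ 0 := by positivity
  have hsum : ∀ N : ℕ, ∑ n ∈ Finset.range N, natBeta n (m + 1) =
      (1 - (m + 1) * natBeta N m) / (m + 1) := by
    intro N
    induction N with
    | zero =>
      rw [natBeta_zero_left]
      field_simp
      simp
    | succ N ih =>
      rw [Finset.sum_range_succ, ih]
      have h1 := natBeta_succ_left N m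
      have h2 := natBeta_succ_right N m
      have h3 : (m + N + 2 : ℝ) ≠ 0 := by positivity
      rw [mul_comm, ← eq_div_iff h3] at h1 h2
      rw [h2]
      rw [h1]
      field_simp
      ring
  have hlim : Tendsto (fun N => natBeta N m) atTop (𝓝 0) := by
    refine squeeze_zero (fun N => natBeta_nonneg N m) (fun N => ?_)
      tendsto_one_div_add_atTop_nhds_zero_nat
    rw [le_div_iff₀ (by positivity)]
    refine le_trans ?_ (mul_natBeta_le_one N m)
    nlinarith [mul_nonneg m.cast_nonneg (natBeta_nonneg N m)]
  simp only [hsum]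
  simpa using ((hlim.const_mul (m + 1 : ℝ)).const_sub 1).div_const (m + 1 : ℝ)

theorem stmt0 (k : ℕ) (hk : 1 ≤ k) :
    ((∑' m : ℕ, aPerm (m + 1) k / (m + 1) : ℝ) : ℂ) = riemannZeta (k + 1) := by
  have hzeta : riemannZeta (k + 1) = ((∑' n : ℕ, 1 / (n + 1 : ℝ) ^ (k + 1) : ℝ) : ℂ) := by
    have h := zeta_nat_eq_tsum_of_gt_one (k := k + 1) (by omega)
    have hs : Summable fun n : ℕ => 1 / (n : ℝ) ^ (k + 1) :=
      Real.summable_one_div_nat_pow.2 (by omega)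
    have h' := hs.tsum_eq_zero_add
    simp only [Nat.cast_zero, zero_pow k.succ_ne_zero, div_zero, zero_add] at h'
    push_cast at h h'
    rw [h, ← h']
    push_cast
    rfl
  rw [hzeta]
  congr 1
  obtain ⟨j, rfl⟩ := Nat.exists_eq_add_of_le' hk
  have hrow : ∀ n, HasSum (fun m => aPerm (m + 1) (j + 1) * natBeta n (m + 1))
      (1 / (n + 1 : ℝ) ^ (j + 1 + 1)) := by
    intro n
    have h := (hasSum_nat_add_iff' 1).2 (hasSum_aPerm_mul_natBeta n (j + 1))
    simpa [aPerm_zero_succ] using h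
  have hcol : ∀ m, HasSum (fun n => aPerm (m + 1) (j + 1) * natBeta n (m + 1))
      (aPerm (m + 1) (j + 1) / (m + 1)) := by
    intro m
    simpa [div_eq_mul_inv] using (hasSum_natBeta_succ m).mul_left (aPerm (m + 1) (j + 1))
  have hsummable : Summable (Function.uncurry fun n m : ℕ =>
      aPerm (m + 1) (j + 1) * natBeta n (m + 1)) := by
    refine (summable_prod_of_nonneg fun p =>
      mul_nonneg (aPerm_nonneg _ _) (natBeta_nonneg _ _)).2 ⟨fun n => (hrow n).summable, ?_⟩
    simp only [(hrow _).tsum_eq]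
    have hs : Summable fun n : ℕ => 1 / (n : ℝ) ^ (j + 1 + 1) :=
      Real.summable_one_div_nat_pow.2 (by omega)
    exact_mod_cast (summable_nat_add_iff 1).2 hs
  have := hsummable.tsum_comm
  simpa only [(hrow _).tsum_eq, (hcol _).tsum_eq] using this
end

section
/- The sequence of iterated integrals I_k, defined by I_0 = 1, I_1 = log 2, and I_k = ∫_{[0,1]^k} dx_1⋯dx_k / (1 + x_1(1 + x_2(⋯(1 + x_k)⋯))) for k ≥ 2, converges to e^{−γ} as k → ∞, with |I_k − e^{−γ}| = O(2^{−k}). -/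
open MeasureTheory
open scoped BigOperators

/-- The nested denominator `1 + x_1(1 + x_2(⋯(1 + x_k)⋯))`. -/
noncomputable def nestDen (k : ℕ) (x : Fin k → ℝ) : ℝ :=
  (List.finRange k).foldr (fun i acc => 1 + x i * acc) 1

/-- The iterated integral `I_k` (with `I_0 = 1`, `I_1 = log 2`). -/
noncomputable def iterI (k : ℕ) : ℝ :=
  ∫ x : Fin k → ℝ in Set.univ.pi (fun _ => Set.Icc (0:ℝ) 1), 1 / nestDen k x

open Set Filter Topology

/-- The entire function `(1 - e⁻ᵗ) / t`. -/
noncomputable def einKernel (t : ℝ) : ℝ := dslope (fun u => -Real.exp (-u)) 0 t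

lemma mul_einKernel (t : ℝ) : t * einKernel t = 1 - Real.exp (-t) := by
  have h := sub_smul_dslope (fun u : ℝ => -Real.exp (-u)) 0 t
  simp only [sub_zero, smul_eq_mul, neg_zero, Real.exp_zero] at h
  rw [einKernel, h]
  ring

lemma continuous_einKernel : Continuous einKernel := by
  rw [← continuousOn_univ]
  refine (continuousOn_dslope univ_mem).2 ⟨by fun_prop, by fun_prop⟩

lemma einKernel_zero : einKernel 0 = 1 := by
  have h : HasDerivAt (fun u : ℝ => -Real.exp (-u)) 1 0 := by
    simpa [Pi.neg_def] using ((hasDerivAt_neg (0 : ℝ)).exp).neg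
  rw [einKernel, dslope_same, h.deriv]

lemma einKernel_nonneg {t : ℝ} (ht : 0 ≤ t) : 0 ≤ einKernel t := by
  rcases ht.eq_or_lt with rfl | ht
  · simp [einKernel_zero]
  · refine nonneg_of_mul_nonneg_right ?_ ht
    rw [mul_einKernel]
    have : Real.exp (-t) ≤ 1 := Real.exp_le_one_iff.2 (by linarith)
    linarith

lemma einKernel_le_one {t : ℝ} (ht : 0 ≤ t) : einKernel t ≤ 1 := by
  rcases ht.eq_or_lt with rfl | ht
  · simp [einKernel_zero]
  · refine le_of_mul_le_mul_left ?_ ht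
    rw [mul_einKernel]
    linarith [Real.add_one_le_exp (-t)]

/-- The complementary exponential integral `Ein`. -/
noncomputable def ein (s : ℝ) : ℝ := ∫ t in (0 : ℝ)..s, einKernel t

lemma hasDerivAt_ein (s : ℝ) : HasDerivAt ein (einKernel s) s :=
  intervalIntegral.integral_hasDerivAt_right (continuous_einKernel.intervalIntegrable _ _)
    (continuous_einKernel.stronglyMeasurableAtFilter _ _) continuous_einKernel.continuousAt

lemma continuous_ein : Continuous ein :=
  continuous_iff_continuousAt.2 fun s => (hasDerivAt_ein s).continuousAt

lemma ein_nonneg {s : ℝ} (hs : 0 ≤ s) : 0 ≤ ein s :=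
  intervalIntegral.integral_nonneg hs fun _ ht => einKernel_nonneg ht.1

lemma ein_le {s : ℝ} (hs : 0 ≤ s) : ein s ≤ s := by
  have h := intervalIntegral.integral_mono_on hs (continuous_einKernel.intervalIntegrable _ _)
    (continuous_const.intervalIntegrable (μ := volume) 0 s)
    (fun t ht => einKernel_le_one ht.1)
  simpa [ein] using h

lemma integral_log_mul_exp_neg :
    ∫ t in Ioi (0 : ℝ), Real.log t * Real.exp (-t) = -Real.eulerMascheroniConstant := by
  have h1 := Complex.hasDerivAt_GammaIntegral (s := 1) (by simp)
  have h2 : HasDerivAt Complex.GammaIntegral (-(Real.eulerMascheroniConstant : ℂ)) 1 := by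
    refine Complex.hasDerivAt_Gamma_one.congr_of_eventuallyEq ?_
    have : IsOpen {s : ℂ | 0 < s.re} := Complex.continuous_re.isOpen_preimage _ isOpen_Ioi
    filter_upwards [this.mem_nhds (show (0 : ℝ) < (1 : ℂ).re by simp)] with a ha
    exact (Complex.Gamma_eq_integral ha).symm
  have h3 := h1.unique h2
  simp only [sub_self, Complex.cpow_zero, one_mul] at h3
  rw [← Complex.ofReal_inj, Complex.ofReal_neg, ← h3, ← integral_complex_ofReal]
  simp

lemma integrableOn_log_mul_exp_neg :
    IntegrableOn (fun t => Real.log t * Real.exp (-t)) (Ioi (0 : ℝ)) := by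
  by_contra h
  have h1 := integral_log_mul_exp_neg
  rw [integral_undef h] at h1
  linarith [Real.one_half_lt_eulerMascheroniConstant]

lemma ein_eq {s : ℝ} (hs : 0 ≤ s) :
    ein s = (1 - Real.exp (-s)) * Real.log s
      - ∫ t in (0 : ℝ)..s, Real.log t * Real.exp (-t) := by
  have hi : IntervalIntegrable (fun t => Real.log t * Real.exp (-t)) volume 0 s :=
    intervalIntegral.intervalIntegrable_log'.mul_continuousOn (by fun_prop)
  have hk : IntervalIntegrable einKernel volume 0 s := continuous_einKernel.intervalIntegrable _ _
  have h := intervalIntegral.integral_eq_sub_of_hasDerivAt_of_le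
    (f := fun t => (1 - Real.exp (-t)) * Real.log t)
    (f' := fun t => Real.log t * Real.exp (-t) + einKernel t) hs ?_ ?_ (hi.add hk)
  · rw [intervalIntegral.integral_add hi hk] at h
    simp only [Real.log_zero, mul_zero, sub_zero] at h
    rw [ein, ← h]
    ring
  · have : Continuous fun t => einKernel t * (t * Real.log t) :=
      continuous_einKernel.mul Real.continuous_mul_log
    refine this.continuousOn.congr fun t _ => ?_
    simp only
    rw [← mul_einKernel]
    ring
  · intro t ht
    have h1 : HasDerivAt (fun t : ℝ => 1 - Real.exp (-t)) (Real.exp (-t)) t := by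
      simpa using ((hasDerivAt_neg t).exp).const_sub 1
    refine (h1.mul (Real.hasDerivAt_log ht.1.ne')).congr_deriv ?_
    rw [← mul_einKernel]
    have := ht.1.ne'
    field_simp

lemma tendsto_mul_exp_neg_ein :
    Tendsto (fun s => s * Real.exp (-ein s)) atTop
      (𝓝 (Real.exp (-Real.eulerMascheroniConstant))) := by
  have h1 := intervalIntegral_tendsto_integral_Ioi 0 integrableOn_log_mul_exp_neg tendsto_id
  rw [integral_log_mul_exp_neg] at h1
  have h2 : Tendsto (fun s : ℝ => Real.exp (-s) * Real.log s) atTop (𝓝 0) := by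
    have h3 : Tendsto (fun s : ℝ => s ^ 1 * Real.exp (-s)) atTop (𝓝 0) :=
      Real.tendsto_pow_mul_exp_neg_atTop_nhds_zero 1
    refine squeeze_zero' ?_ ?_ h3
    · filter_upwards [eventually_ge_atTop 1] with s hs
      exact mul_nonneg (Real.exp_pos _).le (Real.log_nonneg hs)
    · filter_upwards [eventually_ge_atTop 1] with s hs
      rw [pow_one, mul_comm s]
      exact mul_le_mul_of_nonneg_left (Real.log_le_self (by linarith)) (Real.exp_pos _).le
  have h4 := (Real.continuous_exp.tendsto _).comp (h2.add h1)
  rw [zero_add] at h4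
  refine h4.congr' ?_
  filter_upwards [eventually_gt_atTop 0] with s hs
  have : s * Real.exp (-ein s) = Real.exp (Real.log s - ein s) := by
    rw [sub_eq_add_neg, Real.exp_add, Real.exp_log hs]
  rw [this, ein_eq hs.le]
  simp only [Function.comp_apply, id]
  congr 1
  ring

/-- The Laplace transform of the stationary law of the affine recursion `D ↦ 1 + U D`
with `U` uniform on `[0,1]`. -/
noncomputable def limitLaplace (s : ℝ) : ℝ := Real.exp (-s) * Real.exp (-ein s)

lemma continuous_limitLaplace : Continuous limitLaplace := by
  have := continuous_ein
  change Continuous fun s => Real.exp (-s) * Real.exp (-ein s)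
  fun_prop

lemma hasDerivAt_mul_exp_neg_ein (s x : ℝ) :
    HasDerivAt (fun x => x * Real.exp (-ein (s * x))) (limitLaplace (s * x)) x := by
  have h1 : HasDerivAt (fun x => ein (s * x)) (einKernel (s * x) * s) x := by
    have h0 : HasDerivAt (fun x : ℝ => s * x) s x := by simpa using (hasDerivAt_id x).const_mul s
    exact (hasDerivAt_ein (s * x)).comp x h0
  refine ((hasDerivAt_id x).mul h1.neg.exp).congr_deriv ?_
  have h2 := mul_einKernel (s * x)
  have h3 : Real.exp (-(s * x)) = 1 - s * x * einKernel (s * x) := by linarith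
  rw [limitLaplace, h3]
  simp only [id, Pi.neg_apply]
  ring

lemma integral_limitLaplace_mul (s b : ℝ) :
    ∫ x in (0 : ℝ)..b, limitLaplace (s * x) = b * Real.exp (-ein (s * b)) := by
  rw [intervalIntegral.integral_eq_sub_of_hasDerivAt
    (fun x _ => hasDerivAt_mul_exp_neg_ein s x)
    ((continuous_limitLaplace.comp (by fun_prop)).intervalIntegrable _ _)]
  simp

lemma limitLaplace_eq_integral (s : ℝ) :
    limitLaplace s = ∫ x in Icc (0 : ℝ) 1, Real.exp (-s) * limitLaplace (s * x) := by
  rw [integral_const_mul, integral_Icc_eq_integral_Ioc,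
    ← intervalIntegral.integral_of_le zero_le_one, integral_limitLaplace_mul]
  simp [limitLaplace]

lemma limitLaplace_nonneg (s : ℝ) : 0 ≤ limitLaplace s := by
  unfold limitLaplace
  positivity

lemma limitLaplace_le {s : ℝ} (hs : 0 ≤ s) : limitLaplace s ≤ Real.exp (-s) :=
  mul_le_of_le_one_right (Real.exp_pos _).le
    (Real.exp_le_one_iff.2 (by linarith [ein_nonneg hs]))

lemma integrableOn_limitLaplace : IntegrableOn limitLaplace (Ioi 0) := by
  refine Integrable.mono' (integrableOn_exp_neg_Ioi 0)
    continuous_limitLaplace.aestronglyMeasurable ?_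
  filter_upwards [ae_restrict_mem measurableSet_Ioi] with s hs
  rw [Real.norm_of_nonneg (limitLaplace_nonneg s)]
  exact limitLaplace_le (le_of_lt hs)

lemma integral_limitLaplace :
    ∫ s in Ioi (0 : ℝ), limitLaplace s = Real.exp (-Real.eulerMascheroniConstant) := by
  refine tendsto_nhds_unique
    (intervalIntegral_tendsto_integral_Ioi 0 integrableOn_limitLaplace tendsto_id) ?_
  refine tendsto_mul_exp_neg_ein.congr fun s => ?_
  simpa using (integral_limitLaplace_mul 1 s).symm

/-- The uniform probability measure on the cube `[0,1]^k`. -/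
noncomputable def cubeMeasure (k : ℕ) : Measure (Fin k → ℝ) :=
  Measure.pi fun _ => volume.restrict (Icc (0 : ℝ) 1)

instance isProbabilityMeasure_unitInterval :
    IsProbabilityMeasure (volume.restrict (Icc (0 : ℝ) 1)) := ⟨by simp⟩

instance isProbabilityMeasure_cubeMeasure (k : ℕ) : IsProbabilityMeasure (cubeMeasure k) := by
  unfold cubeMeasure
  infer_instance

lemma restrict_cube (k : ℕ) :
    (volume : Measure (Fin k → ℝ)).restrict (univ.pi fun _ => Icc (0 : ℝ) 1) = cubeMeasure k := by
  rw [volume_pi, Measure.restrict_pi_pi, cubeMeasure]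

lemma nestDen_succ (k : ℕ) (x : Fin (k + 1) → ℝ) :
    nestDen (k + 1) x = 1 + x 0 * nestDen k (fun i => x i.succ) := by
  simp [nestDen, List.finRange_succ, List.foldr_map]

lemma nestDen_zero (x : Fin 0 → ℝ) : nestDen 0 x = 1 := by
  simp [nestDen]

lemma continuous_nestDen (k : ℕ) : Continuous (nestDen k) := by
  induction k with
  | zero => exact continuous_const.congr fun x => (nestDen_zero x).symm
  | succ k ih =>
    have : Continuous fun x : Fin (k + 1) → ℝ => 1 + x 0 * nestDen k (fun i => x i.succ) := by
      fun_prop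
    exact this.congr fun x => (nestDen_succ k x).symm

lemma one_le_nestDen (k : ℕ) {x : Fin k → ℝ} (hx : ∀ i, 0 ≤ x i) : 1 ≤ nestDen k x := by
  induction k with
  | zero => rw [nestDen_zero]
  | succ k ih =>
    rw [nestDen_succ]
    have h := ih fun i => hx i.succ
    have := mul_nonneg (hx 0) (zero_le_one.trans h)
    linarith

lemma ae_one_le_nestDen (k : ℕ) : ∀ᵐ x ∂cubeMeasure k, 1 ≤ nestDen k x := by
  rw [← restrict_cube]
  filter_upwards [ae_restrict_mem (MeasurableSet.univ_pi fun _ => measurableSet_Icc)] with x hx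
  exact one_le_nestDen k fun i => (hx i (mem_univ i)).1

/-- The Laplace transform of the law of `nestDen k` under the uniform measure on the cube. -/
noncomputable def nestLaplace (k : ℕ) (s : ℝ) : ℝ :=
  ∫ x, Real.exp (-(s * nestDen k x)) ∂cubeMeasure k

lemma integrable_exp_neg_nestDen (k : ℕ) {s : ℝ} (hs : 0 ≤ s) :
    Integrable (fun x => Real.exp (-(s * nestDen k x))) (cubeMeasure k) := by
  have hc := continuous_nestDen k
  refine Integrable.of_bound (C := 1) (Continuous.aestronglyMeasurable (by fun_prop)) ?_
  filter_upwards [ae_one_le_nestDen k] with x hx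
  rw [Real.norm_of_nonneg (Real.exp_pos _).le, Real.exp_le_one_iff]
  have := mul_nonneg hs (zero_le_one.trans hx)
  linarith

lemma nestLaplace_zero (s : ℝ) : nestLaplace 0 s = Real.exp (-s) := by
  simp [nestLaplace, nestDen_zero]

lemma nestLaplace_succ (k : ℕ) {s : ℝ} (hs : 0 ≤ s) :
    IntegrableOn (fun x => Real.exp (-s) * nestLaplace k (s * x)) (Icc (0 : ℝ) 1) ∧
    nestLaplace (k + 1) s = ∫ x in Icc (0 : ℝ) 1, Real.exp (-s) * nestLaplace k (s * x) := by
  have hmp := (measurePreserving_piFinSuccAbove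
    (fun _ : Fin (k + 1) => (volume : Measure ℝ).restrict (Icc (0 : ℝ) 1)) 0).symm
  have he (z : ℝ × (Fin k → ℝ)) :
      Real.exp (-(s * nestDen (k + 1)
        ((MeasurableEquiv.piFinSuccAbove (fun _ => ℝ) 0).symm z))) =
      Real.exp (-s) * Real.exp (-(s * z.1 * nestDen k z.2)) := by
    rw [nestDen_succ, ← Real.exp_add]
    simp [MeasurableEquiv.piFinSuccAbove]
    ring
  have hint := (hmp.integrable_comp_emb (MeasurableEquiv.measurableEmbedding _)).2
    (integrable_exp_neg_nestDen (k + 1) hs)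
  simp only [Function.comp_def, he] at hint
  have heq := hmp.integral_comp' (fun x => Real.exp (-(s * nestDen (k + 1) x)))
  simp only [he] at heq
  constructor
  · have h := hint.integral_prod_left
    simp only [integral_const_mul] at h
    exact h
  · rw [integral_prod _ hint] at heq
    simp only [integral_const_mul] at heq
    rw [integral_const_mul]
    exact heq.symm

lemma abs_nestLaplace_sub_le (k : ℕ) {s : ℝ} (hs : 0 ≤ s) :
    |nestLaplace k s - limitLaplace s| ≤ Real.exp (-s) * s / 2 ^ k := by
  induction k generalizing s with
  | zero =>
    rw [nestLaplace_zero, abs_of_nonneg (sub_nonneg.2 (limitLaplace_le hs)), limitLaplace]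
    have h1 : 1 - Real.exp (-ein s) ≤ s := by
      linarith [Real.add_one_le_exp (-ein s), ein_le hs]
    have := mul_le_mul_of_nonneg_left h1 (Real.exp_pos (-s)).le
    simp only [pow_zero, div_one]
    linarith
  | succ k ih =>
    obtain ⟨hi, he⟩ := nestLaplace_succ k hs
    have hi2 : IntegrableOn (fun x => Real.exp (-s) * limitLaplace (s * x)) (Icc (0 : ℝ) 1) :=
      (continuous_const.mul (continuous_limitLaplace.comp (by fun_prop))).integrableOn_Icc
    rw [he, limitLaplace_eq_integral, ← integral_sub hi hi2, ← Real.norm_eq_abs]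
    have hb : IntegrableOn (fun x : ℝ => Real.exp (-s) * s / 2 ^ k * x) (Icc (0 : ℝ) 1) :=
      Continuous.integrableOn_Icc (by fun_prop)
    refine (norm_integral_le_of_norm_le hb ?_).trans_eq ?_
    · filter_upwards [ae_restrict_mem measurableSet_Icc] with x hx
      rw [← mul_sub, norm_mul, Real.norm_of_nonneg (Real.exp_pos _).le, Real.norm_eq_abs]
      have hsx := mul_nonneg hs hx.1
      have h0 : Real.exp (-(s * x)) ≤ 1 := Real.exp_le_one_iff.2 (by linarith)
      have h1 : Real.exp (-(s * x)) * (s * x) / 2 ^ k ≤ s * x / 2 ^ k :=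
        div_le_div_of_nonneg_right (mul_le_of_le_one_left hsx h0) (by positivity)
      calc Real.exp (-s) * |nestLaplace k (s * x) - limitLaplace (s * x)|
          ≤ Real.exp (-s) * (s * x / 2 ^ k) := by gcongr; exact (ih hsx).trans h1
        _ = _ := by ring
    · rw [integral_const_mul, integral_Icc_eq_integral_Ioc,
        ← intervalIntegral.integral_of_le zero_le_one, integral_id, pow_succ]
      field_simp
      ring

lemma iterI_eq_integral_nestLaplace (k : ℕ) :
    IntegrableOn (nestLaplace k) (Ioi 0) ∧ iterI k = ∫ s in Ioi (0 : ℝ), nestLaplace k s := by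
  have hc := continuous_nestDen k
  have hint : Integrable (fun z : (ℝ × (Fin k → ℝ)) => Real.exp (-(z.1 * nestDen k z.2)))
      ((volume.restrict (Ioi 0)).prod (cubeMeasure k)) := by
    refine Integrable.mono' ((integrableOn_exp_neg_Ioi 0).integrable.comp_fst (cubeMeasure k))
      (Continuous.aestronglyMeasurable (by fun_prop)) ?_
    have h1 := Measure.quasiMeasurePreserving_fst (μ := (volume : Measure ℝ).restrict (Ioi 0))
      (ν := cubeMeasure k) |>.ae (ae_restrict_mem measurableSet_Ioi)
    have h2 := Measure.quasiMeasurePreserving_snd (μ := (volume : Measure ℝ).restrict (Ioi 0))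
      (ν := cubeMeasure k) |>.ae (ae_one_le_nestDen k)
    filter_upwards [h1, h2] with z hz1 hz2
    rw [Real.norm_of_nonneg (Real.exp_pos _).le, Real.exp_le_exp, neg_le_neg_iff]
    exact le_mul_of_one_le_right (le_of_lt hz1) hz2
  refine ⟨hint.integral_prod_left, ?_⟩
  have hswap := integral_integral_swap
    (f := fun (s : ℝ) (x : Fin k → ℝ) => Real.exp (-(s * nestDen k x))) hint
  simp only [nestLaplace]
  rw [hswap, iterI, restrict_cube]
  refine integral_congr_ae ?_
  filter_upwards [ae_one_le_nestDen k] with x hx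
  have h := integral_exp_mul_Ioi (a := -nestDen k x) (by linarith) 0
  simp only [mul_zero, Real.exp_zero, neg_div_neg_eq] at h
  rw [← h]
  refine integral_congr_ae (Eventually.of_forall fun s => ?_)
  simp only
  congr 1
  ring

lemma abs_iterI_sub_le (k : ℕ) :
    |iterI k - Real.exp (-Real.eulerMascheroniConstant)| ≤ 1 / 2 ^ k := by
  obtain ⟨hi, he⟩ := iterI_eq_integral_nestLaplace k
  rw [he, ← integral_limitLaplace, ← integral_sub hi integrableOn_limitLaplace,
    ← Real.norm_eq_abs]
  have hG : IntegrableOn (fun s : ℝ => Real.exp (-s) * s) (Ioi 0) ∧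
      ∫ s in Ioi (0 : ℝ), Real.exp (-s) * s = 1 := by
    have h1 := Real.GammaIntegral_convergent (s := 2) two_pos
    have h2 := Real.Gamma_eq_integral (s := 2) two_pos
    rw [Real.Gamma_two] at h2
    norm_num at h1 h2
    exact ⟨h1, h2.symm⟩
  refine (norm_integral_le_of_norm_le (hG.1.div_const (2 ^ k)) ?_).trans_eq ?_
  · filter_upwards [ae_restrict_mem measurableSet_Ioi] with s hs
    exact abs_nestLaplace_sub_le k (le_of_lt hs)
  · rw [integral_div, hG.2]

theorem stmt11 :
    (∃ C : ℝ, 0 < C ∧ ∀ k : ℕ,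
      |iterI k - Real.exp (-Real.eulerMascheroniConstant)| ≤ C / 2 ^ k) ∧
    Filter.Tendsto iterI Filter.atTop
      (nhds (Real.exp (-Real.eulerMascheroniConstant))) := by
  refine ⟨⟨1, one_pos, abs_iterI_sub_le⟩, ?_⟩
  rw [tendsto_iff_dist_tendsto_zero]
  refine squeeze_zero (fun _ => dist_nonneg) abs_iterI_sub_le ?_
  simpa using tendsto_pow_atTop_nhds_zero_of_lt_one (r := (2 : ℝ)⁻¹) (by norm_num) (by norm_num)
end

section
/- For every prime y ≥ 2 and real s ≥ 1, the function G_y(s,z) := ∏_{p≤y}(1−p^{−s})^z ∏_{p>y}(1−z p^{−s})^{−1}(1−p^{−s})^z (ζ(s)(s−1))^z, as a function of complex z, is holomorphic in the disc |z| < y₁^s (where y₁ is the smallest prime exceeding y), except for simple poles at z = p^s for primes p with y < p ≤ y₁; in particular for s = 1 its Taylor coefficients at z = 0 satisfy [z^i] G_y(1,z) ≪_y y₁^{−i}. -/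
open scoped BigOperators

/-- The function `G_y(s,z)`: Euler product over primes, with the factor
`(1-p^{-s})^z` for `p ≤ y` and `(1-z p^{-s})⁻¹ (1-p^{-s})^z` for `p > y`,
times `(ζ(s)(s-1))^z` (interpreted as `1^z` at `s = 1`). -/
noncomputable def Gfun (y : ℕ) (s : ℝ) (z : ℂ) : ℂ :=
  (∏' p : Nat.Primes,
    if (p : ℕ) ≤ y then (1 - ((p : ℕ) : ℂ) ^ (-(s : ℂ))) ^ z
    else (1 - z * ((p : ℕ) : ℂ) ^ (-(s : ℂ)))⁻¹ * (1 - ((p : ℕ) : ℂ) ^ (-(s : ℂ))) ^ z) *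
  (if s = 1 then 1 else riemannZeta (s : ℂ) * ((s : ℂ) - 1)) ^ z

open Metric in
/-- The Taylor coefficients at `0` of a function with a single simple pole at `ρ` in a disc of
radius larger than `ρ` are `O(ρ⁻ⁱ)`. -/
theorem exists_norm_iteratedDeriv_le_of_simple_pole {H G : ℂ → ℂ} {ρ R : ℝ} (hρ : 0 < ρ)
    (hR : ρ < R) (hH : DifferentiableOn ℂ H (ball 0 R))
    (hG : ∀ z ∈ ball (0 : ℂ) ρ, G z = H z * (1 - z * (ρ : ℂ)⁻¹)⁻¹) :
    ∃ C : ℝ, ∀ i : ℕ, ‖iteratedDeriv i G 0‖ / (Nat.factorial i) ≤ C / ρ ^ i := by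
  have hρ0 : (ρ : ℂ) ≠ 0 := by exact_mod_cast hρ.ne'
  have hmem : (ρ : ℂ) ∈ ball (0 : ℂ) R := by
    simpa [abs_of_pos hρ] using hR
  have hD : DifferentiableOn ℂ (dslope H ρ) (ball 0 R) :=
    (Complex.differentiableOn_dslope (isOpen_ball.mem_nhds hmem)).mpr hH
  have hsub : closedBall (0 : ℂ) ρ ⊆ ball 0 R := closedBall_subset_ball hR
  obtain ⟨M, hM⟩ := (isCompact_closedBall (0 : ℂ) ρ).exists_bound_of_continuousOn
    (hD.mono hsub).continuousOn
  have hDc : ∀ i : ℕ, ‖iteratedDeriv i (dslope H ρ) 0‖ ≤ i.factorial * M / ρ ^ i := fun i =>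
    Complex.norm_iteratedDeriv_le_of_forall_mem_sphere_norm_le i hρ
      ((hD.mono hsub).diffContOnCl_ball subset_rfl) fun z hz => hM z (sphere_subset_closedBall hz)
  have hDan : AnalyticAt ℂ (dslope H ρ) 0 :=
    hD.analyticAt (isOpen_ball.mem_nhds (mem_ball_self (hρ.trans hR)))
  have hIan : AnalyticAt ℂ (fun z : ℂ => (1 * z - (ρ : ℂ))⁻¹) 0 :=
    AnalyticAt.inv (by fun_prop) (by simpa using hρ0)
  have hGeq : G =ᶠ[nhds 0]
      fun z => (-(ρ : ℂ) * H ρ) * (1 * z - (ρ : ℂ))⁻¹ + (-(ρ : ℂ)) * dslope H ρ z := by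
    filter_upwards [ball_mem_nhds (0 : ℂ) hρ] with z hz
    have hne : z ≠ (ρ : ℂ) := by
      rintro rfl
      simp [abs_of_pos hρ] at hz
    have hne' : z - (ρ : ℂ) ≠ 0 := sub_ne_zero.mpr hne
    have hinv : (1 - z * (ρ : ℂ)⁻¹)⁻¹ = -(ρ : ℂ) * (z - ρ)⁻¹ := by
      rw [show 1 - z * (ρ : ℂ)⁻¹ = -(z - ρ) * (ρ : ℂ)⁻¹ by field_simp; ring]
      rw [mul_inv, inv_inv, inv_neg]
      ring
    rw [hG z hz, hinv, dslope_of_ne _ hne, slope_def_field]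
    field_simp
    ring
  refine ⟨‖H ρ‖ + ρ * M, fun i => ?_⟩
  have hfac : (0 : ℝ) < i.factorial := by exact_mod_cast i.factorial_pos
  rw [hGeq.iteratedDeriv_eq i, iteratedDeriv_fun_add
    (contDiffAt_const.mul hIan.contDiffAt) (contDiffAt_const.mul hDan.contDiffAt),
    iteratedDeriv_const_mul_field, iteratedDeriv_const_mul_field, div_le_iff₀ hfac]
  have hI : ‖iteratedDeriv i (fun z : ℂ => (1 * z - (ρ : ℂ))⁻¹) 0‖
      = i.factorial / (ρ * ρ ^ i) := by
    rw [iteratedDeriv_eq_iterate, iter_deriv_inv_linear_sub]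
    beta_reduce
    rw [show (-1 - (i : ℤ)) = -((i + 1 : ℕ) : ℤ) by push_cast; ring, zpow_neg, zpow_natCast]
    simp [abs_of_pos hρ, pow_succ', div_eq_mul_inv, mul_comm]
  calc _ ≤ ‖-(ρ : ℂ) * H ρ‖ * (i.factorial / (ρ * ρ ^ i))
        + ‖-(ρ : ℂ)‖ * (i.factorial * M / ρ ^ i) := by
        refine (norm_add_le _ _).trans ?_
        rw [norm_mul, norm_mul _ (iteratedDeriv i (dslope H ρ) 0), hI]
        gcongr
        exact hDc i
    _ = (‖H ρ‖ + ρ * M) / ρ ^ i * i.factorial := by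
        simp only [norm_mul, norm_neg, Complex.norm_real, Real.norm_eq_abs, abs_of_pos hρ]
        field_simp

/-- The logarithm of the `p`-th Euler factor, where the pole of the factors with `p ≤ N` has been
removed. -/
noncomputable def logFactor (N : ℕ) (s : ℝ) (p : Nat.Primes) (z : ℂ) : ℂ :=
  z * Complex.log (1 - ((p : ℕ) : ℂ) ^ (-(s : ℂ))) -
    if (p : ℕ) ≤ N then 0 else Complex.log (1 - z * ((p : ℕ) : ℂ) ^ (-(s : ℂ)))

theorem norm_prime_cpow_neg (p : Nat.Primes) (s : ℝ) :
    ‖((p : ℕ) : ℂ) ^ (-(s : ℂ))‖ = ((p : ℕ) : ℝ) ^ (-s) := by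
  rw [Complex.norm_natCast_cpow_of_pos p.2.pos]
  simp

theorem norm_prime_cpow_neg_le_half (p : Nat.Primes) {s : ℝ} (hs : 1 ≤ s) :
    ‖((p : ℕ) : ℂ) ^ (-(s : ℂ))‖ ≤ 1 / 2 := by
  have h2 : (2 : ℝ) ≤ (p : ℕ) := by exact_mod_cast p.2.two_le
  rw [norm_prime_cpow_neg, Real.rpow_neg (by positivity), one_div]
  refine inv_anti₀ two_pos (h2.trans ?_)
  simpa using Real.rpow_le_rpow_of_exponent_le (by linarith : (1 : ℝ) ≤ (p : ℕ)) hs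

theorem summable_norm_prime_cpow_neg_sq {s : ℝ} (hs : 1 ≤ s) :
    Summable fun p : Nat.Primes => ‖((p : ℕ) : ℂ) ^ (-(s : ℂ))‖ ^ 2 := by
  refine (Nat.Primes.summable_rpow.mpr (by linarith : -s * 2 < -1)).congr fun p => ?_
  rw [norm_prime_cpow_neg, Real.rpow_mul (Nat.cast_nonneg _)]
  norm_cast

theorem norm_mul_prime_cpow_neg_le {N : ℕ} {s r : ℝ} (hs : 1 ≤ s) {p : Nat.Primes}
    (hp : N < (p : ℕ)) {z : ℂ} (hz : ‖z‖ ≤ r) :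
    ‖z * ((p : ℕ) : ℂ) ^ (-(s : ℂ))‖ ≤ r / ((N : ℝ) + 1) ^ s := by
  rw [norm_mul, norm_prime_cpow_neg, div_eq_mul_inv, Real.rpow_neg (Nat.cast_nonneg _)]
  have h : ((N : ℝ) + 1) ^ s ≤ ((p : ℕ) : ℝ) ^ s :=
    Real.rpow_le_rpow (by positivity) (by exact_mod_cast hp) (by linarith)
  have h0 : 0 < ((N : ℝ) + 1) ^ s := by positivity
  have := (norm_nonneg z).trans hz
  gcongr

theorem norm_log_one_sub_add_self_le {w : ℂ} {ρ : ℝ} (hρ : ρ < 1) (hw : ‖w‖ ≤ ρ) :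
    ‖Complex.log (1 - w) + w‖ ≤ ‖w‖ ^ 2 * ((1 - ρ)⁻¹ / 2) := by
  have h := Complex.norm_log_one_add_sub_self_le (z := -w) (by rw [norm_neg]; linarith)
  rw [norm_neg, sub_neg_eq_add, ← sub_eq_add_neg, mul_div_assoc] at h
  refine h.trans ?_
  have : (0 : ℝ) < 1 - ρ := by linarith
  gcongr

theorem exists_norm_logFactor_le {N : ℕ} {s r : ℝ} (hs : 1 ≤ s) (hr : r < ((N : ℝ) + 1) ^ s) :
    ∃ C : ℝ, ∀ (p : Nat.Primes) (z : ℂ), ‖z‖ ≤ r →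
      ‖logFactor N s p z‖ ≤ C * ‖((p : ℕ) : ℂ) ^ (-(s : ℂ))‖ ^ 2 := by
  have h0 : 0 < ((N : ℝ) + 1) ^ s := by positivity
  set ρ := r / ((N : ℝ) + 1) ^ s with hρ
  have hρ1 : ρ < 1 := (div_lt_one h0).mpr hr
  refine ⟨r + r * ((N : ℝ) + 1) ^ s + r ^ 2 * ((1 - ρ)⁻¹ / 2), fun p z hz => ?_⟩
  have hr0 : 0 ≤ r := (norm_nonneg z).trans hz
  have hρ' : 0 < 1 - ρ := by linarith
  set x := ((p : ℕ) : ℂ) ^ (-(s : ℂ)) with hx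
  have hlog : ‖z * (Complex.log (1 - x) + x)‖ ≤ r * ‖x‖ ^ 2 := by
    rw [norm_mul]
    have := norm_log_one_sub_add_self_le (ρ := 1 / 2) (by norm_num)
      (norm_prime_cpow_neg_le_half p hs)
    rw [← hx] at this
    norm_num at this
    gcongr
  rw [logFactor, ← hx]
  split_ifs with hp
  · have hxN : ‖x‖ ≤ ((N : ℝ) + 1) ^ s * ‖x‖ ^ 2 := by
      have hp0 : (0 : ℝ) < (p : ℕ) := by exact_mod_cast p.2.pos
      have hle : ((p : ℕ) : ℝ) ^ s ≤ ((N : ℝ) + 1) ^ s :=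
        Real.rpow_le_rpow hp0.le (by exact_mod_cast hp.trans N.le_succ) (by linarith)
      have hone : 1 ≤ ((N : ℝ) + 1) ^ s * ‖x‖ := by
        rw [hx, norm_prime_cpow_neg, Real.rpow_neg hp0.le, ← div_eq_mul_inv]
        exact (one_le_div (by positivity)).mpr hle
      nlinarith [norm_nonneg x]
    calc _ = ‖z * (Complex.log (1 - x) + x) - z * x‖ := by congr 1; ring
      _ ≤ r * ‖x‖ ^ 2 + r * (((N : ℝ) + 1) ^ s * ‖x‖ ^ 2) := by
        refine (norm_sub_le _ _).trans (add_le_add hlog ?_)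
        rw [norm_mul]
        gcongr
      _ ≤ _ := by
        have : 0 ≤ r ^ 2 * ((1 - ρ)⁻¹ / 2) * ‖x‖ ^ 2 := by positivity
        linarith
  · have hzx := norm_mul_prime_cpow_neg_le hs (not_le.mp hp) hz
    rw [← hx] at hzx
    calc _ = ‖z * (Complex.log (1 - x) + x) - (Complex.log (1 - z * x) + z * x)‖ := by
          congr 1; ring
      _ ≤ r * ‖x‖ ^ 2 + (r * ‖x‖) ^ 2 * ((1 - ρ)⁻¹ / 2) := by
        refine (norm_sub_le _ _).trans (add_le_add hlog ?_)
        refine (norm_log_one_sub_add_self_le hρ1 hzx).trans ?_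
        rw [norm_mul]
        gcongr
      _ ≤ _ := by
        have : 0 ≤ r * ((N : ℝ) + 1) ^ s * ‖x‖ ^ 2 := by positivity
        linarith

theorem one_sub_mem_slitPlane {w : ℂ} (hw : ‖w‖ < 1) : 1 - w ∈ Complex.slitPlane := by
  simpa [sub_eq_add_neg] using Complex.mem_slitPlane_of_norm_lt_one (z := -w) (by simpa using hw)

theorem norm_mul_prime_cpow_neg_lt_one {N : ℕ} {s : ℝ} (hs : 1 ≤ s) {p : Nat.Primes}
    (hp : N < (p : ℕ)) {z : ℂ} (hz : ‖z‖ < ((N : ℝ) + 1) ^ s) :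
    ‖z * ((p : ℕ) : ℂ) ^ (-(s : ℂ))‖ < 1 :=
  (norm_mul_prime_cpow_neg_le hs hp le_rfl).trans_lt ((div_lt_one (by positivity)).mpr hz)

theorem differentiableOn_logFactor {N : ℕ} {s : ℝ} (hs : 1 ≤ s) (p : Nat.Primes) :
    DifferentiableOn ℂ (logFactor N s p) (Metric.ball 0 (((N : ℝ) + 1) ^ s)) := by
  intro z hz
  apply DifferentiableAt.differentiableWithinAt
  unfold logFactor
  split_ifs with hp
  · fun_prop
  · refine DifferentiableAt.sub (by fun_prop) (DifferentiableAt.clog (by fun_prop) ?_)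
    exact one_sub_mem_slitPlane
      (norm_mul_prime_cpow_neg_lt_one hs (not_le.mp hp) (by simpa using hz))

theorem summable_logFactor {N : ℕ} {s : ℝ} (hs : 1 ≤ s) {z : ℂ}
    (hz : ‖z‖ < ((N : ℝ) + 1) ^ s) : Summable fun p => logFactor N s p z := by
  obtain ⟨C, hC⟩ := exists_norm_logFactor_le hs hz
  exact Summable.of_norm_bounded ((summable_norm_prime_cpow_neg_sq hs).mul_left C)
    fun p => hC p z le_rfl

theorem differentiableOn_tsum_logFactor {N : ℕ} {s : ℝ} (hs : 1 ≤ s) :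
    DifferentiableOn ℂ (fun z => ∑' p, logFactor N s p z)
      (Metric.ball 0 (((N : ℝ) + 1) ^ s)) := by
  intro z hz
  obtain ⟨r, hzr, hr⟩ := exists_between (mem_ball_zero_iff.mp hz)
  obtain ⟨C, hC⟩ := exists_norm_logFactor_le hs hr
  have h := Complex.differentiableOn_tsum_of_summable_norm (U := Metric.ball 0 r)
    ((summable_norm_prime_cpow_neg_sq hs).mul_left C)
    (fun p => (differentiableOn_logFactor (N := N) hs p).mono (Metric.ball_subset_ball hr.le))
    Metric.isOpen_ball fun p w hw => hC p w (mem_ball_zero_iff.mp hw).le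
  exact (h.differentiableAt
    (Metric.isOpen_ball.mem_nhds (mem_ball_zero_iff.mpr hzr))).differentiableWithinAt

/-- `Gfun` with its pole at `z = N ^ s` removed, where `N` is the least prime exceeding `y`. -/
noncomputable def regularPart (N : ℕ) (s : ℝ) (z : ℂ) : ℂ :=
  Complex.exp (∑' p, logFactor N s p z) *
    (if s = 1 then 1 else riemannZeta (s : ℂ) * ((s : ℂ) - 1)) ^ z

theorem zetaFactor_ne_zero {s : ℝ} (hs : 1 ≤ s) :
    (if s = 1 then 1 else riemannZeta (s : ℂ) * ((s : ℂ) - 1)) ≠ 0 := by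
  split_ifs with h
  · exact one_ne_zero
  · exact mul_ne_zero (riemannZeta_ne_zero_of_one_le_re (by simpa using hs))
      (sub_ne_zero.mpr (by exact_mod_cast h))

theorem regularPart_ne_zero {N : ℕ} {s : ℝ} (hs : 1 ≤ s) (z : ℂ) : regularPart N s z ≠ 0 :=
  mul_ne_zero (Complex.exp_ne_zero _)
    (by rw [Ne, Complex.cpow_eq_zero_iff]; exact fun h => zetaFactor_ne_zero hs h.1)

theorem differentiableOn_regularPart {N : ℕ} {s : ℝ} (hs : 1 ≤ s) :
    DifferentiableOn ℂ (regularPart N s) (Metric.ball 0 (((N : ℝ) + 1) ^ s)) :=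
  (differentiableOn_tsum_logFactor hs).cexp.mul
    (differentiableOn_id.const_cpow (Or.inl (zetaFactor_ne_zero hs)))

theorem Gfun_eq_regularPart_mul {y N : ℕ} (hN : N.Prime) (hlt : y < N)
    (hmin : ∀ p : ℕ, p.Prime → y < p → N ≤ p) {s : ℝ} (hs : 1 ≤ s) {z : ℂ}
    (hz : ‖z‖ < ((N : ℝ) + 1) ^ s) :
    Gfun y s z = regularPart N s z * (1 - z * (N : ℂ) ^ (-(s : ℂ)))⁻¹ := by
  obtain ⟨q, rfl⟩ : ∃ q : Nat.Primes, (q : ℕ) = N := ⟨⟨N, hN⟩, rfl⟩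
  have h := (summable_logFactor hs hz).hasSum.cexp.mul
    (hasProd_ite_eq q (1 - z * ((q : ℕ) : ℂ) ^ (-(s : ℂ)))⁻¹)
  rw [Gfun, regularPart, mul_right_comm, ← h.tprod_eq]
  congr 1
  refine tprod_congr fun p => ?_
  have hx : 1 - ((p : ℕ) : ℂ) ^ (-(s : ℂ)) ≠ 0 := Complex.slitPlane_ne_zero
    (one_sub_mem_slitPlane ((norm_prime_cpow_neg_le_half p hs).trans_lt (by norm_num)))
  rw [Function.comp_apply, logFactor, Complex.exp_sub, Complex.cpow_def_of_ne_zero hx,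
    mul_comm z (Complex.log _)]
  rcases lt_trichotomy (p : ℕ) q with hp | hp | hp
  · have hpy : (p : ℕ) ≤ y := not_lt.mp fun h => (hmin p p.2 h).not_gt hp
    have hne : p ≠ q := fun h => hp.ne (congrArg Subtype.val h)
    simp [hpy, hp.le, hne]
  · obtain rfl : p = q := Subtype.ext hp
    simp [hlt.not_ge, mul_comm]
  · have hne : p ≠ q := fun h => hp.ne' (congrArg Subtype.val h)
    have hzx : 1 - z * ((p : ℕ) : ℂ) ^ (-(s : ℂ)) ≠ 0 := Complex.slitPlane_ne_zero
      (one_sub_mem_slitPlane (norm_mul_prime_cpow_neg_lt_one hs hp hz))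
    simp only [(hlt.trans hp).not_ge, hp.not_ge, hne, if_false, Complex.exp_log hzx]
    rw [mul_one, div_eq_mul_inv, mul_comm]

theorem stmt13 (y y₁ : ℕ) (hy : y.Prime) (hy₁ : y₁.Prime) (hlt : y < y₁)
    (hmin : ∀ p : ℕ, p.Prime → y < p → y₁ ≤ p) (s : ℝ) (hs : 1 ≤ s) :
    (DifferentiableOn ℂ (Gfun y s)
      (Metric.ball (0:ℂ) ((y₁ : ℝ) ^ s) \
        {z : ℂ | ∃ p : ℕ, p.Prime ∧ y < p ∧ p ≤ y₁ ∧ z = ((p : ℕ) : ℂ) ^ (s : ℂ)})) ∧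
    (∀ p : ℕ, p.Prime → y < p → p ≤ y₁ →
      ∃ c : ℂ, c ≠ 0 ∧
        Filter.Tendsto (fun z => (z - ((p : ℕ) : ℂ) ^ (s : ℂ)) * Gfun y s z)
          (nhdsWithin (((p : ℕ) : ℂ) ^ (s : ℂ)) {((p : ℕ) : ℂ) ^ (s : ℂ)}ᶜ) (nhds c)) ∧
    (s = 1 → ∃ C : ℝ, ∀ i : ℕ,
      ‖iteratedDeriv i (Gfun y 1) 0‖ / (Nat.factorial i) ≤ C / (y₁ : ℝ) ^ i) := by
  have hpos : (0 : ℝ) < y₁ := by exact_mod_cast hy₁.pos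
  have hlt_rpow : (y₁ : ℝ) ^ s < ((y₁ : ℝ) + 1) ^ s :=
    Real.rpow_lt_rpow hpos.le (lt_add_one _) (by linarith)
  have hball := Metric.ball_subset_ball (x := (0 : ℂ)) hlt_rpow.le
  have hne : ((y₁ : ℕ) : ℂ) ^ (s : ℂ) ≠ 0 := by
    rw [Ne, Complex.cpow_eq_zero_iff]
    exact fun h => hpos.ne' (by exact_mod_cast h.1)
  have hnorm : ‖((y₁ : ℕ) : ℂ) ^ (s : ℂ)‖ = (y₁ : ℝ) ^ s := by
    rw [Complex.norm_natCast_cpow_of_pos hy₁.pos, Complex.ofReal_re]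
  refine ⟨?_, ?_, ?_⟩
  · have hd : DifferentiableOn ℂ
        (fun z => regularPart y₁ s z * (1 - z * (y₁ : ℂ) ^ (-(s : ℂ)))⁻¹)
        (Metric.ball 0 ((y₁ : ℝ) ^ s)) := by
      refine ((differentiableOn_regularPart hs).mono hball).mul
        (DifferentiableOn.inv (by fun_prop) fun z hz h => ?_)
      rw [Complex.cpow_neg, ← div_eq_mul_inv, sub_eq_zero, eq_comm, div_eq_one_iff_eq hne] at h
      rw [mem_ball_zero_iff, h, hnorm] at hz
      exact lt_irrefl _ hz
    refine (hd.congr fun z hz => ?_).mono Set.sdiff_subset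
    exact Gfun_eq_regularPart_mul hy₁ hlt hmin hs (mem_ball_zero_iff.mp (hball hz))
  · intro p hp hyp hpy
    obtain rfl : p = y₁ := le_antisymm hpy (hmin p hp hyp)
    have hmem : ((p : ℕ) : ℂ) ^ (s : ℂ) ∈ Metric.ball (0 : ℂ) (((p : ℝ) + 1) ^ s) := by
      rwa [mem_ball_zero_iff, hnorm]
    have hnhds := Metric.isOpen_ball.mem_nhds hmem
    refine ⟨regularPart p s ((p : ℂ) ^ (s : ℂ)) * (-(p : ℂ) ^ (s : ℂ)),
      mul_ne_zero (regularPart_ne_zero hs _) (neg_ne_zero.mpr hne), ?_⟩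
    have hc : ContinuousAt (fun z => regularPart p s z * (-(p : ℂ) ^ (s : ℂ)))
        ((p : ℂ) ^ (s : ℂ)) :=
      ((differentiableOn_regularPart hs).differentiableAt hnhds).continuousAt.mul
        continuousAt_const
    refine (hc.tendsto.mono_left nhdsWithin_le_nhds).congr' ?_
    filter_upwards [self_mem_nhdsWithin, nhdsWithin_le_nhds hnhds] with z hz hzb
    have hz' : z - (p : ℂ) ^ (s : ℂ) ≠ 0 := sub_ne_zero.mpr hz
    rw [Gfun_eq_regularPart_mul hy₁ hlt hmin hs (mem_ball_zero_iff.mp hzb), Complex.cpow_neg,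
      show 1 - z * ((p : ℂ) ^ (s : ℂ))⁻¹ = -(z - (p : ℂ) ^ (s : ℂ)) * ((p : ℂ) ^ (s : ℂ))⁻¹ by
        field_simp; ring,
      mul_inv, inv_inv, inv_neg]
    field_simp
  · rintro rfl
    simp only [Real.rpow_one] at hball
    refine exists_norm_iteratedDeriv_le_of_simple_pole hpos (lt_add_one (y₁ : ℝ))
      (H := regularPart y₁ 1) (by simpa using differentiableOn_regularPart (N := y₁) le_rfl)
      fun z hz => ?_
    have h := Gfun_eq_regularPart_mul hy₁ hlt hmin le_rfl (z := z)
      (by simpa using mem_ball_zero_iff.mp (hball hz))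
    rw [h, Complex.ofReal_one, Complex.cpow_neg_one, Complex.ofReal_natCast]
end
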